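/- For any function u of class C⁴ on Ω_r = ℝ × (r₊,∞) × (0,π), the operators □ₘ and □̄ₘ commute: □ₘ(□̄ₘ u) = □̄ₘ(□ₘ u). -/

import Mathlib

noncomputable section

/-- Functions of `(t, r, θ)`. -/
abbrev F3 := ℝ × ℝ × ℝ → ℂ

/-- Partial derivative with respect to `t`. -/
noncomputable def dT (u : F3) (p : ℝ × ℝ × ℝ) : ℂ :=
  deriv (fun s => u (s, p.2.1, p.2.2)) p.1

/-- Partial derivative with respect to `r`. -/
noncomputable def dR (u : F3) (p : ℝ × ℝ × ℝ) : ℂ :=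
  deriv (fun s => u (p.1, s, p.2.2)) p.2.1

/-- Partial derivative with respect to `θ`. -/
noncomputable def dTh (u : F3) (p : ℝ × ℝ × ℝ) : ℂ :=
  deriv (fun s => u (p.1, p.2.1, s)) p.2.2

/-- `Δ = r² - 2Mr + a²`. -/
def Del (M a r : ℝ) : ℝ := r ^ 2 - 2 * M * r + a ^ 2

/-- `Σ = r² + a² cos² θ`. -/
def Sig (a r θ : ℝ) : ℝ := r ^ 2 + a ^ 2 * Real.cos θ ^ 2

/-- `r₊ = M + √(M² - a²)`. -/
noncomputable def rplus (M a : ℝ) : ℝ := M + Real.sqrt (M ^ 2 - a ^ 2)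

/-- `Ω_r = ℝ × (r₊, ∞) × (0, π)`. -/
def OmegaR (M a : ℝ) : Set (ℝ × ℝ × ℝ) :=
  {p | rplus M a < p.2.1 ∧ 0 < p.2.2 ∧ p.2.2 < Real.pi}

/-- The reduced Kerr wave operator `□ₘ`. -/
noncomputable def boxm (M a : ℝ) (m : ℤ) (u : F3) : F3 := fun p =>
  (Complex.ofReal (Sig a p.2.1 p.2.2))⁻¹ *
    (Complex.ofReal ((p.2.1 ^ 2 + a ^ 2) ^ 2 / Del M a p.2.1
        - a ^ 2 * Real.sin p.2.2 ^ 2) * dT (dT u) p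
      + 4 * Complex.I * (m : ℂ) * Complex.ofReal M * Complex.ofReal a
          * Complex.ofReal p.2.1 / Complex.ofReal (Del M a p.2.1) * dT u p
      - dR (fun q => Complex.ofReal (Del M a q.2.1) * dR u q) p
      - (Complex.ofReal (Real.sin p.2.2))⁻¹
          * dTh (fun q => Complex.ofReal (Real.sin q.2.2) * dTh u q) p
      - (m : ℂ) ^ 2 * Complex.ofReal (a ^ 2 / Del M a p.2.1
          - (Real.sin p.2.2 ^ 2)⁻¹) * u p)

/-- The Killing-tensor operator `□̄ₘ`. -/
noncomputable def barboxm (M a : ℝ) (m : ℤ) (u : F3) : F3 := fun p =>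
  (Complex.ofReal (Sig a p.2.1 p.2.2))⁻¹ *
    (Complex.ofReal (a ^ 2 * (p.2.1 ^ 2 * Real.sin p.2.2 ^ 2
        + Real.cos p.2.2 ^ 2 * (p.2.1 ^ 2 + a ^ 2) ^ 2 / Del M a p.2.1)) * dT (dT u) p
      + 2 * Complex.I * (m : ℂ) * Complex.ofReal a
          * Complex.ofReal (p.2.1 ^ 2 + a ^ 2 * Real.cos p.2.2 ^ 2
              * (p.2.1 ^ 2 + a ^ 2) / Del M a p.2.1) * dT u p
      - Complex.ofReal (a ^ 2 * Real.cos p.2.2 ^ 2)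
          * dR (fun q => Complex.ofReal (Del M a q.2.1) * dR u q) p
      + Complex.ofReal (p.2.1 ^ 2 / Real.sin p.2.2)
          * dTh (fun q => Complex.ofReal (Real.sin q.2.2) * dTh u q) p
      - (m : ℂ) ^ 2 * Complex.ofReal (p.2.1 ^ 2 / Real.sin p.2.2 ^ 2
          + a ^ 4 * Real.cos p.2.2 ^ 2 / Del M a p.2.1) * u p)

/-- The ladder operator `Dₙ`. -/
noncomputable def Dlad (M a : ℝ) (m n : ℤ) (u : F3) : F3 := fun p =>
  dR u p + (Complex.ofReal (Del M a p.2.1))⁻¹ *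
      (Complex.ofReal (p.2.1 ^ 2 + a ^ 2) * dT u p
        + Complex.I * (m : ℂ) * Complex.ofReal a * u p)
    + Complex.ofReal (2 * (n : ℝ) * (p.2.1 - M) / Del M a p.2.1) * u p

/-- The ladder operator `Dₙ⁺`. -/
noncomputable def DladP (M a : ℝ) (m n : ℤ) (u : F3) : F3 := fun p =>
  dR u p - (Complex.ofReal (Del M a p.2.1))⁻¹ *
      (Complex.ofReal (p.2.1 ^ 2 + a ^ 2) * dT u p
        + Complex.I * (m : ℂ) * Complex.ofReal a * u p)
    + Complex.ofReal (2 * (n : ℝ) * (p.2.1 - M) / Del M a p.2.1) * u p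

/-- The ladder operator `Lₙ`. -/
noncomputable def Llad (a : ℝ) (m n : ℤ) (u : F3) : F3 := fun p =>
  dTh u p + (-Complex.I * Complex.ofReal a * Complex.ofReal (Real.sin p.2.2) * dT u p
      + (m : ℂ) * (Complex.ofReal (Real.sin p.2.2))⁻¹ * u p)
    + (n : ℂ) * Complex.ofReal (Real.cos p.2.2 / Real.sin p.2.2) * u p

/-- The ladder operator `Lₙ⁺`. -/
noncomputable def LladP (a : ℝ) (m n : ℤ) (u : F3) : F3 := fun p =>
  dTh u p - (-Complex.I * Complex.ofReal a * Complex.ofReal (Real.sin p.2.2) * dT u p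
      + (m : ℂ) * (Complex.ofReal (Real.sin p.2.2))⁻¹ * u p)
    + (n : ℂ) * Complex.ofReal (Real.cos p.2.2 / Real.sin p.2.2) * u p

/-- `D² = D₁D₀⁺ + D₁⁺D₀`. -/
noncomputable def D2 (M a : ℝ) (m : ℤ) (u : F3) : F3 := fun p =>
  Dlad M a m 1 (DladP M a m 0 u) p + DladP M a m 1 (Dlad M a m 0 u) p

/-- `L² = L₁L₀⁺ + L₁⁺L₀`. -/
noncomputable def L2 (a : ℝ) (m : ℤ) (u : F3) : F3 := fun p =>
  Llad a m 1 (LladP a m 0 u) p + LladP a m 1 (Llad a m 0 u) p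

/-- The operator `P` appearing in the symmetry operator `S`. -/
noncomputable def Pop (M a : ℝ) (m : ℤ) (u : F3) : F3 := fun p =>
  -2 * Complex.I * (m : ℂ) * Complex.ofReal a
      * Complex.ofReal ((p.2.1 ^ 2 + a ^ 2) * Sig a p.2.1 p.2.2) * dT u p
    - Complex.ofReal (a ^ 2 * Real.sin p.2.2 ^ 2 * Del M a p.2.1)
        * dR (fun q => Complex.ofReal (Del M a q.2.1) * dR u q) p
    - Complex.ofReal ((p.2.1 ^ 2 + a ^ 2) ^ 2 / Real.sin p.2.2)
        * dTh (fun q => Complex.ofReal (Real.sin q.2.2) * dTh u q) p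
    + (m : ℂ) ^ 2 * Complex.ofReal (Sig a p.2.1 p.2.2 / Real.sin p.2.2 ^ 2
        * (Sig a p.2.1 p.2.2 + 2 * a ^ 2 * Real.sin p.2.2 ^ 2)) * u p

/-- The new first-order-in-time symmetry operator `S`. -/
noncomputable def Sop (M a : ℝ) (m : ℤ) (u : F3) : F3 := fun p =>
  (Complex.ofReal ((p.2.1 ^ 2 + a ^ 2) * Sig a p.2.1 p.2.2
      + 2 * M * a ^ 2 * p.2.1 * Real.sin p.2.2 ^ 2))⁻¹ * Pop M a m u p

end

section DirectionalDerivative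

variable {E : Type*} [NormedAddCommGroup E] [NormedSpace ℝ E] {U : Set E}

/-- The derivative of `f` in the direction `v`. -/
noncomputable def dirDeriv (v : E) (f : E → ℂ) (p : E) : ℂ := fderiv ℝ f p v

lemma dirDeriv_congr (hU : IsOpen U) {f g : E → ℂ} (h : Set.EqOn f g U) (v : E) :
    Set.EqOn (dirDeriv v f) (dirDeriv v g) U := fun p hp => by
  unfold dirDeriv
  rw [(h.eventuallyEq_of_mem (hU.mem_nhds hp)).fderiv_eq]

lemma ContDiffOn.dirDeriv (hU : IsOpen U) {f : E → ℂ} {m n : WithTop ℕ∞}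
    (hf : ContDiffOn ℝ n f U) (hmn : m + 1 ≤ n) (v : E) :
    ContDiffOn ℝ m (dirDeriv v f) U :=
  (hf.fderiv_of_isOpen hU hmn).clm_apply contDiffOn_const

lemma ContDiffOn.differentiableAt_of_isOpen (hU : IsOpen U) {f : E → ℂ} {n : WithTop ℕ∞}
    (hf : ContDiffOn ℝ n f U) (hn : n ≠ 0) {p : E} (hp : p ∈ U) :
    DifferentiableAt ℝ f p :=
  (hf.differentiableOn hn).differentiableAt (hU.mem_nhds hp)

lemma dirDeriv_comm (hU : IsOpen U) {f : E → ℂ} (hf : ContDiffOn ℝ 2 f U) (v w : E)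
    {p : E} (hp : p ∈ U) :
    dirDeriv v (dirDeriv w f) p = dirDeriv w (dirDeriv v f) p := by
  have hd : DifferentiableAt ℝ (fderiv ℝ f) p :=
    ((hf.fderiv_of_isOpen (m := 1) hU (by norm_num)).differentiableOn
      (by norm_num)).differentiableAt (hU.mem_nhds hp)
  have key : ∀ v w : E, dirDeriv v (dirDeriv w f) p = fderiv ℝ (fderiv ℝ f) p v w := by
    intro v w
    unfold dirDeriv
    rw [fderiv_clm_apply hd (differentiableAt_const w)]
    simp
  rw [key, key]
  exact ((hf.contDiffAt (hU.mem_nhds hp)).isSymmSndFDerivAt (by simp)).eq v w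

lemma dirDeriv_add {f g : E → ℂ} {p : E} (hf : DifferentiableAt ℝ f p)
    (hg : DifferentiableAt ℝ g p) (v : E) :
    dirDeriv v (fun q => f q + g q) p = dirDeriv v f p + dirDeriv v g p := by
  simp [dirDeriv, fderiv_fun_add hf hg]

lemma dirDeriv_mul {f g : E → ℂ} {p : E} (hf : DifferentiableAt ℝ f p)
    (hg : DifferentiableAt ℝ g p) (v : E) :
    dirDeriv v (fun q => f q * g q) p = dirDeriv v f p * g p + f p * dirDeriv v g p := by
  simp [dirDeriv, fderiv_fun_mul hf hg]
  ring

lemma dirDeriv_mul_of_eq_zero {c f : E → ℂ} {p : E} {v : E} (hc : DifferentiableAt ℝ c p)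
    (hf : DifferentiableAt ℝ f p) (h : dirDeriv v c p = 0) :
    dirDeriv v (fun q => c q * f q) p = c p * dirDeriv v f p := by
  rw [dirDeriv_mul hc hf, h]
  ring

lemma dirDeriv_eq_zero_of_invariant {c : E → ℂ} {v : E} (h : ∀ p (s : ℝ), c (p + s • v) = c p)
    (p : E) : dirDeriv v c p = 0 := by
  unfold dirDeriv
  by_cases hd : DifferentiableAt ℝ c p
  · rw [← hd.lineDeriv_eq_fderiv]
    simp [lineDeriv, h]
  · simp [fderiv_zero_of_not_differentiableAt hd]

/-- The second order operator in the directions `t` and `v` with coefficients `k`. -/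
noncomputable def secondOrderOp (t v : E) (k : Fin 5 → E → ℂ) (f : E → ℂ) (p : E) : ℂ :=
  k 0 p * dirDeriv t (dirDeriv t f) p + k 1 p * dirDeriv t f p
    + k 2 p * dirDeriv v (dirDeriv v f) p + k 3 p * dirDeriv v f p + k 4 p * f p

variable {t v w : E} {k l : Fin 5 → E → ℂ} {f g : E → ℂ}

lemma secondOrderOp_congr (hU : IsOpen U) (h : Set.EqOn f g U) :
    Set.EqOn (secondOrderOp t v k f) (secondOrderOp t v k g) U := fun p hp => by
  have h1 := dirDeriv_congr hU h
  simp only [secondOrderOp, h hp, h1 _ hp, dirDeriv_congr hU (h1 t) t hp,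
    dirDeriv_congr hU (h1 v) v hp]

lemma ContDiffOn.secondOrderOp (hU : IsOpen U) {n : WithTop ℕ∞}
    (hk : ∀ i, ContDiffOn ℝ n (k i) U) (hf : ContDiffOn ℝ (n + 2) f U) :
    ContDiffOn ℝ n (secondOrderOp t v k f) U := by
  have h1 (v : E) : ContDiffOn ℝ (n + 1) (_root_.dirDeriv v f) U :=
    hf.dirDeriv hU (by rw [add_assoc, one_add_one_eq_two]) v
  have h2 (v : E) := (h1 v).dirDeriv hU le_rfl v
  have h0 (v : E) : ContDiffOn ℝ n (_root_.dirDeriv v f) U := (h1 v).of_le le_self_add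
  exact (((((hk 0).mul (h2 t)).add ((hk 1).mul (h0 t))).add ((hk 2).mul (h2 v))).add
    ((hk 3).mul (h0 v))).add ((hk 4).mul (hf.of_le le_self_add))

lemma dirDeriv_dirDeriv_add (hU : IsOpen U) (hf : ContDiffOn ℝ 2 f U)
    (hg : ContDiffOn ℝ 2 g U) {p : E} (hp : p ∈ U) (v : E) :
    dirDeriv v (dirDeriv v fun q => f q + g q) p
      = dirDeriv v (dirDeriv v f) p + dirDeriv v (dirDeriv v g) p := by
  have hd {F : E → ℂ} (hF : ContDiffOn ℝ 2 F U) :=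
    (hF.dirDeriv (m := 1) hU (by norm_num) v).differentiableAt_of_isOpen hU one_ne_zero hp
  rw [dirDeriv_congr hU (g := fun q => dirDeriv v f q + dirDeriv v g q)
    (fun q hq => dirDeriv_add (hf.differentiableAt_of_isOpen hU two_ne_zero hq)
      (hg.differentiableAt_of_isOpen hU two_ne_zero hq) v) v hp,
    dirDeriv_add (hd hf) (hd hg)]

lemma dirDeriv_dirDeriv_mul_of_eq_zero (hU : IsOpen U) {c : E → ℂ} (hc : ContDiffOn ℝ 2 c U)
    (hf : ContDiffOn ℝ 2 f U) (h : ∀ p ∈ U, dirDeriv v c p = 0) {p : E} (hp : p ∈ U) :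
    dirDeriv v (dirDeriv v fun q => c q * f q) p = c p * dirDeriv v (dirDeriv v f) p := by
  rw [dirDeriv_congr hU (g := fun q => c q * dirDeriv v f q)
    (fun q hq => dirDeriv_mul_of_eq_zero (hc.differentiableAt_of_isOpen hU two_ne_zero hq)
      (hf.differentiableAt_of_isOpen hU two_ne_zero hq) (h q hq)) v hp,
    dirDeriv_mul_of_eq_zero (hc.differentiableAt_of_isOpen hU two_ne_zero hp)
      ((hf.dirDeriv (m := 1) hU (by norm_num) v).differentiableAt_of_isOpen hU one_ne_zero hp)
      (h p hp)]

lemma secondOrderOp_add (hU : IsOpen U) (hf : ContDiffOn ℝ 2 f U) (hg : ContDiffOn ℝ 2 g U)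
    {p : E} (hp : p ∈ U) :
    secondOrderOp t v k (fun q => f q + g q) p
      = secondOrderOp t v k f p + secondOrderOp t v k g p := by
  have hf1 := hf.differentiableAt_of_isOpen hU two_ne_zero hp
  have hg1 := hg.differentiableAt_of_isOpen hU two_ne_zero hp
  simp only [secondOrderOp, dirDeriv_add hf1 hg1, dirDeriv_dirDeriv_add hU hf hg hp]
  ring

lemma secondOrderOp_mul (hU : IsOpen U) {c : E → ℂ} (hc : ContDiffOn ℝ 2 c U)
    (hf : ContDiffOn ℝ 2 f U) (ht : ∀ p ∈ U, dirDeriv t c p = 0)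
    (hv : ∀ p ∈ U, dirDeriv v c p = 0) {p : E} (hp : p ∈ U) :
    secondOrderOp t v k (fun q => c q * f q) p = c p * secondOrderOp t v k f p := by
  have hf1 := hf.differentiableAt_of_isOpen hU two_ne_zero hp
  have hc1 := hc.differentiableAt_of_isOpen hU two_ne_zero hp
  simp only [secondOrderOp, dirDeriv_mul_of_eq_zero hc1 hf1 (ht p hp),
    dirDeriv_mul_of_eq_zero hc1 hf1 (hv p hp),
    dirDeriv_dirDeriv_mul_of_eq_zero hU hc hf ht hp,
    dirDeriv_dirDeriv_mul_of_eq_zero hU hc hf hv hp]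
  ring

lemma dirDeriv_secondOrderOp (hU : IsOpen U) (hk : ∀ i, ContDiffOn ℝ 2 (k i) U)
    (hw : ∀ i, ∀ p ∈ U, dirDeriv w (k i) p = 0) (hf : ContDiffOn ℝ 3 f U) {p : E} (hp : p ∈ U) :
    dirDeriv w (secondOrderOp t v k f) p = secondOrderOp t v k (dirDeriv w f) p := by
  have h1 (v : E) : ContDiffOn ℝ 2 (dirDeriv v f) U := hf.dirDeriv hU (by norm_num) v
  have h2 (v : E) : ContDiffOn ℝ 1 (dirDeriv v (dirDeriv v f)) U :=
    (h1 v).dirDeriv hU (by norm_num) v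
  have hk' (i) := (hk i).differentiableAt_of_isOpen hU two_ne_zero hp
  have d0 := hf.differentiableAt_of_isOpen hU three_ne_zero hp
  have d1 (v : E) := (h1 v).differentiableAt_of_isOpen hU two_ne_zero hp
  have d2 (v : E) := (h2 v).differentiableAt_of_isOpen hU one_ne_zero hp
  have hcomm (v : E) : Set.EqOn (dirDeriv w (dirDeriv v f)) (dirDeriv v (dirDeriv w f)) U :=
    fun q hq => dirDeriv_comm hU (hf.of_le (by norm_num)) w v hq
  have hcomm2 (v : E) : dirDeriv w (dirDeriv v (dirDeriv v f)) p
      = dirDeriv v (dirDeriv v (dirDeriv w f)) p := by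
    rw [dirDeriv_comm hU (h1 v) w v hp, dirDeriv_congr hU (hcomm v) v hp]
  have e0 := (hk' 0).fun_mul (d2 t)
  have e1 := (hk' 1).fun_mul (d1 t)
  have e2 := (hk' 2).fun_mul (d2 v)
  have e3 := (hk' 3).fun_mul (d1 v)
  have e4 := (hk' 4).fun_mul d0
  unfold secondOrderOp
  rw [dirDeriv_add (((e0.fun_add e1).fun_add e2).fun_add e3) e4,
    dirDeriv_add ((e0.fun_add e1).fun_add e2) e3,
    dirDeriv_add (e0.fun_add e1) e2, dirDeriv_add e0 e1,
    dirDeriv_mul_of_eq_zero (hk' 0) (d2 t) (hw 0 p hp),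
    dirDeriv_mul_of_eq_zero (hk' 1) (d1 t) (hw 1 p hp),
    dirDeriv_mul_of_eq_zero (hk' 2) (d2 v) (hw 2 p hp),
    dirDeriv_mul_of_eq_zero (hk' 3) (d1 v) (hw 3 p hp),
    dirDeriv_mul_of_eq_zero (hk' 4) d0 (hw 4 p hp), hcomm2, hcomm2, hcomm t hp, hcomm v hp]

/-- Two operators separated in the variables `v` and `w` commute. -/
lemma secondOrderOp_comm (hU : IsOpen U) (hk : ∀ i, ContDiffOn ℝ 2 (k i) U)
    (hl : ∀ i, ContDiffOn ℝ 2 (l i) U)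
    (hkt : ∀ i, ∀ p ∈ U, dirDeriv t (k i) p = 0) (hkw : ∀ i, ∀ p ∈ U, dirDeriv w (k i) p = 0)
    (hlt : ∀ i, ∀ p ∈ U, dirDeriv t (l i) p = 0) (hlv : ∀ i, ∀ p ∈ U, dirDeriv v (l i) p = 0)
    (hf : ContDiffOn ℝ 4 f U) {p : E} (hp : p ∈ U) :
    secondOrderOp t v k (secondOrderOp t w l f) p
      = secondOrderOp t w l (secondOrderOp t v k f) p := by
  have h0 : ContDiffOn ℝ 2 f U := hf.of_le (by norm_num)
  have h1 (v : E) : ContDiffOn ℝ 3 (dirDeriv v f) U := hf.dirDeriv hU (by norm_num) v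
  have h1' (v : E) : ContDiffOn ℝ 2 (dirDeriv v f) U := (h1 v).of_le (by norm_num)
  have h2 (v : E) : ContDiffOn ℝ 2 (dirDeriv v (dirDeriv v f)) U :=
    (h1 v).dirDeriv hU (by norm_num) v
  have first {x : E} (hx : ∀ i, ∀ p ∈ U, dirDeriv x (l i) p = 0) :
      Set.EqOn (dirDeriv x (secondOrderOp t w l f)) (secondOrderOp t w l (dirDeriv x f)) U :=
    fun q hq => dirDeriv_secondOrderOp hU hl hx (hf.of_le (by norm_num)) hq
  have second {x : E} (hx : ∀ i, ∀ p ∈ U, dirDeriv x (l i) p = 0) :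
      dirDeriv x (dirDeriv x (secondOrderOp t w l f)) p
        = secondOrderOp t w l (dirDeriv x (dirDeriv x f)) p := by
    rw [dirDeriv_congr hU (first hx) x hp, dirDeriv_secondOrderOp hU hl hx (h1 x) hp]
  have m0 := (hk 0).mul (h2 t)
  have m1 := (hk 1).mul (h1' t)
  have m2 := (hk 2).mul (h2 v)
  have m3 := (hk 3).mul (h1' v)
  have m4 := (hk 4).mul h0
  conv_rhs => rw [show secondOrderOp t v k f = fun p =>
    k 0 p * dirDeriv t (dirDeriv t f) p + k 1 p * dirDeriv t f p
    + k 2 p * dirDeriv v (dirDeriv v f) p + k 3 p * dirDeriv v f p + k 4 p * f p from rfl]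
  rw [secondOrderOp_add hU (((m0.add m1).add m2).add m3) m4 hp,
    secondOrderOp_add hU ((m0.add m1).add m2) m3 hp,
    secondOrderOp_add hU (m0.add m1) m2 hp, secondOrderOp_add hU m0 m1 hp,
    secondOrderOp_mul hU (hk 0) (h2 t) (hkt 0) (hkw 0) hp,
    secondOrderOp_mul hU (hk 1) (h1' t) (hkt 1) (hkw 1) hp,
    secondOrderOp_mul hU (hk 2) (h2 v) (hkt 2) (hkw 2) hp,
    secondOrderOp_mul hU (hk 3) (h1' v) (hkt 3) (hkw 3) hp,
    secondOrderOp_mul hU (hk 4) h0 (hkt 4) (hkw 4) hp,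
    ← second hlt, ← second hlv, ← first hlt hp, ← first hlv hp]
  rfl

/-- If `(x + y) □ = A + B` and `(x + y) K = x A - y B` with `A`, `B` separated operators, and
`x`, `y` functions annihilated by the derivatives in `A` and `B` respectively, then `□` and `K`
commute. Here `F = □ f` and `G = K f`. -/
lemma separated_comm (hU : IsOpen U) (hk : ∀ i, ContDiffOn ℝ 2 (k i) U)
    (hl : ∀ i, ContDiffOn ℝ 2 (l i) U)
    (hkt : ∀ i, ∀ p ∈ U, dirDeriv t (k i) p = 0) (hkw : ∀ i, ∀ p ∈ U, dirDeriv w (k i) p = 0)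
    (hlt : ∀ i, ∀ p ∈ U, dirDeriv t (l i) p = 0) (hlv : ∀ i, ∀ p ∈ U, dirDeriv v (l i) p = 0)
    (hf : ContDiffOn ℝ 4 f U) {x y F G : E → ℂ}
    (hx : ContDiffOn ℝ 2 x U) (hy : ContDiffOn ℝ 2 y U)
    (hxt : ∀ p ∈ U, dirDeriv t x p = 0) (hxv : ∀ p ∈ U, dirDeriv v x p = 0)
    (hyt : ∀ p ∈ U, dirDeriv t y p = 0) (hyw : ∀ p ∈ U, dirDeriv w y p = 0)
    (hF : ContDiffOn ℝ 2 F U) (hG : ContDiffOn ℝ 2 G U)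
    (hA : ∀ p ∈ U, secondOrderOp t v k f p = y p * F p + G p)
    (hB : ∀ p ∈ U, secondOrderOp t w l f p = x p * F p + (-1) * G p) {p : E} (hp : p ∈ U) :
    x p * secondOrderOp t v k F p - y p * secondOrderOp t w l F p
      = secondOrderOp t v k G p + secondOrderOp t w l G p := by
  have h := secondOrderOp_comm hU hk hl hkt hkw hlt hlv hf hp
  have hz (v : E) : ∀ p ∈ U, dirDeriv v (fun _ : E => (-1 : ℂ)) p = 0 := fun p _ =>
    dirDeriv_eq_zero_of_invariant (fun _ _ => rfl) p
  rw [secondOrderOp_congr hU hA hp, secondOrderOp_congr hU hB hp,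
    secondOrderOp_add hU (hx.mul hF) (contDiffOn_const.mul hG) hp,
    secondOrderOp_mul hU hx hF hxt hxv hp,
    secondOrderOp_mul hU contDiffOn_const hG (hz _) (hz _) hp,
    secondOrderOp_add hU (hy.mul hF) hG hp, secondOrderOp_mul hU hy hF hyt hyw hp] at h
  linear_combination h

end DirectionalDerivative

section Kerr

lemma isOpen_OmegaR (M a : ℝ) : IsOpen (OmegaR M a) := by
  have hr : Continuous fun p : ℝ × ℝ × ℝ => p.2.1 := by fun_prop
  have hθ : Continuous fun p : ℝ × ℝ × ℝ => p.2.2 := by fun_prop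
  exact (isOpen_lt continuous_const hr).inter
    ((isOpen_lt continuous_const hθ).inter (isOpen_lt hθ continuous_const))

lemma dT_eq_dirDeriv {f : F3} {p : ℝ × ℝ × ℝ} (hf : DifferentiableAt ℝ f p) :
    dT f p = dirDeriv (1, 0, 0) f p := by
  have h : HasDerivAt (fun s : ℝ => (s, p.2.1, p.2.2)) (1, 0, 0) p.1 :=
    (hasDerivAt_id _).prodMk (hasDerivAt_const _ _)
  exact (HasFDerivAt.comp_hasDerivAt p.1 (f := fun s : ℝ => (s, p.2.1, p.2.2))
    hf.hasFDerivAt h).deriv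

lemma dR_eq_dirDeriv {f : F3} {p : ℝ × ℝ × ℝ} (hf : DifferentiableAt ℝ f p) :
    dR f p = dirDeriv (0, 1, 0) f p := by
  have h : HasDerivAt (fun s : ℝ => (p.1, s, p.2.2)) (0, 1, 0) p.2.1 :=
    (hasDerivAt_const _ _).prodMk ((hasDerivAt_id _).prodMk (hasDerivAt_const _ _))
  exact (HasFDerivAt.comp_hasDerivAt p.2.1 (f := fun s : ℝ => (p.1, s, p.2.2))
    hf.hasFDerivAt h).deriv

lemma dTh_eq_dirDeriv {f : F3} {p : ℝ × ℝ × ℝ} (hf : DifferentiableAt ℝ f p) :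
    dTh f p = dirDeriv (0, 0, 1) f p := by
  have h : HasDerivAt (fun s : ℝ => (p.1, p.2.1, s)) (0, 0, 1) p.2.2 :=
    (hasDerivAt_const _ _).prodMk ((hasDerivAt_const _ _).prodMk (hasDerivAt_id _))
  exact (HasFDerivAt.comp_hasDerivAt p.2.2 (f := fun s : ℝ => (p.1, p.2.1, s))
    hf.hasFDerivAt h).deriv

/-- Iterating a partial derivative that agrees with a directional derivative. -/
lemma partial_mul_partial {U : Set (ℝ × ℝ × ℝ)} (hU : IsOpen U) {v : ℝ × ℝ × ℝ} {d : F3 → F3}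
    (hd : ∀ {f : F3} {p : ℝ × ℝ × ℝ}, DifferentiableAt ℝ f p → d f p = dirDeriv v f p)
    {c f : F3} (hc : Differentiable ℝ c) (hf : ContDiffOn ℝ 2 f U) {p : ℝ × ℝ × ℝ} (hp : p ∈ U) :
    d (fun q => c q * d f q) p = d c p * dirDeriv v f p + c p * dirDeriv v (dirDeriv v f) p := by
  have h1 := (hf.dirDeriv (m := 1) hU (by norm_num) v).differentiableAt_of_isOpen hU one_ne_zero hp
  have he : Set.EqOn (fun q => c q * d f q) (fun q => c q * dirDeriv v f q) U := fun q hq => by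
    simp only [hd (hf.differentiableAt_of_isOpen hU two_ne_zero hq)]
  have h2 : DifferentiableAt ℝ (fun q => c q * d f q) p :=
    ((hc p).fun_mul h1).congr_of_eventuallyEq (he.eventuallyEq_of_mem (hU.mem_nhds hp))
  rw [hd h2, dirDeriv_congr hU he v hp, dirDeriv_mul (hc p) h1, hd (hc p)]

/-- Coefficients of the radial part of `Σ □ₘ`. -/
noncomputable def radialCoeff (M a : ℝ) (m : ℤ) (i : Fin 5) (p : ℝ × ℝ × ℝ) : ℂ :=
  (![1, 4 * Complex.I * m * M * a, -1, -1, -(m : ℂ) ^ 2] : Fin 5 → ℂ) i *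
    Complex.ofReal ((![fun r => (r ^ 2 + a ^ 2) ^ 2 / Del M a r, fun r => r / Del M a r,
      fun r => Del M a r, fun r => 2 * r - 2 * M, fun r => a ^ 2 / Del M a r] :
      Fin 5 → ℝ → ℝ) i p.2.1)

/-- Coefficients of the angular part of `Σ □ₘ`. -/
noncomputable def angularCoeff (a : ℝ) (m : ℤ) (i : Fin 5) (p : ℝ × ℝ × ℝ) : ℂ :=
  (![-(a : ℂ) ^ 2, 0, -1, -1, (m : ℂ) ^ 2] : Fin 5 → ℂ) i *
    Complex.ofReal ((![fun θ => Real.sin θ ^ 2, fun _ => 0, fun _ => 1,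
      fun θ => Real.cos θ / Real.sin θ, fun θ => (Real.sin θ ^ 2)⁻¹] :
      Fin 5 → ℝ → ℝ) i p.2.2)

/-- The radial part of `Σ □ₘ`. -/
noncomputable def radialOp (M a : ℝ) (m : ℤ) : F3 → F3 :=
  secondOrderOp (1, 0, 0) (0, 1, 0) (radialCoeff M a m)

/-- The angular part of `Σ □ₘ`. -/
noncomputable def angularOp (a : ℝ) (m : ℤ) : F3 → F3 :=
  secondOrderOp (1, 0, 0) (0, 0, 1) (angularCoeff a m)

variable {M a : ℝ} {m : ℤ}

lemma Del_pos_of_mem (haM : |a| ≤ M) {p : ℝ × ℝ × ℝ} (hp : p ∈ OmegaR M a) :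
    0 < Del M a p.2.1 := by
  have h : Real.sqrt (M ^ 2 - a ^ 2) < p.2.1 - M := by
    have := hp.1
    unfold rplus at this
    linarith
  have h0 : 0 ≤ M ^ 2 - a ^ 2 := sub_nonneg.2 (sq_le_sq' (abs_le.1 haM).1 (abs_le.1 haM).2)
  have := (Real.sqrt_lt' ((Real.sqrt_nonneg _).trans_lt h)).1 h
  unfold Del
  linarith

lemma sin_pos_of_mem {p : ℝ × ℝ × ℝ} (hp : p ∈ OmegaR M a) : 0 < Real.sin p.2.2 :=
  Real.sin_pos_of_pos_of_lt_pi hp.2.1 hp.2.2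

lemma Sig_pos_of_mem (hM : 0 < M) {p : ℝ × ℝ × ℝ} (hp : p ∈ OmegaR M a) :
    0 < Sig a p.2.1 p.2.2 := by
  have h := hp.1
  have : 0 < p.2.1 := by
    unfold rplus at h
    linarith [Real.sqrt_nonneg (M ^ 2 - a ^ 2)]
  unfold Sig
  positivity

lemma ContDiffOn.ofReal {E : Type*} [NormedAddCommGroup E] [NormedSpace ℝ E] {U : Set E}
    {n : WithTop ℕ∞} {f : E → ℝ} (hf : ContDiffOn ℝ n f U) :
    ContDiffOn ℝ n (fun p => (f p : ℂ)) U :=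
  Complex.ofRealCLM.contDiff.comp_contDiffOn hf

lemma contDiffOn_radialCoeff (haM : |a| ≤ M) (i : Fin 5) {n : WithTop ℕ∞} :
    ContDiffOn ℝ n (radialCoeff M a m i) (OmegaR M a) := by
  have hD : ContDiffOn ℝ n (fun p : ℝ × ℝ × ℝ => Del M a p.2.1) (OmegaR M a) := by
    unfold Del
    fun_prop
  have hne : ∀ p ∈ OmegaR M a, Del M a p.2.1 ≠ 0 := fun p hp => (Del_pos_of_mem haM hp).ne'
  refine contDiffOn_const.mul (ContDiffOn.ofReal ?_)
  fin_cases i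
  · exact ContDiffOn.div (by fun_prop) hD hne
  · exact ContDiffOn.div (by fun_prop) hD hne
  · exact hD
  · simp only [Fin.reduceFinMk, Matrix.cons_val]
    fun_prop
  · exact ContDiffOn.div (by fun_prop) hD hne

lemma contDiffOn_angularCoeff (i : Fin 5) {n : WithTop ℕ∞} :
    ContDiffOn ℝ n (angularCoeff a m i) (OmegaR M a) := by
  have hs : ContDiffOn ℝ n (fun p : ℝ × ℝ × ℝ => Real.sin p.2.2) (OmegaR M a) := by fun_prop
  have hne : ∀ p ∈ OmegaR M a, Real.sin p.2.2 ≠ 0 := fun p hp => (sin_pos_of_mem hp).ne'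
  refine contDiffOn_const.mul (ContDiffOn.ofReal ?_)
  fin_cases i
  · exact hs.pow 2
  · exact contDiffOn_const
  · exact contDiffOn_const
  · exact ContDiffOn.div (by fun_prop) hs hne
  · exact (hs.pow 2).inv fun p hp => pow_ne_zero 2 (hne p hp)

lemma contDiffOn_inv_Sig (hM : 0 < M) {n : WithTop ℕ∞} :
    ContDiffOn ℝ n (fun p : ℝ × ℝ × ℝ => (Complex.ofReal (Sig a p.2.1 p.2.2))⁻¹)
      (OmegaR M a) := by
  have h : ContDiffOn ℝ n (fun p : ℝ × ℝ × ℝ => Sig a p.2.1 p.2.2) (OmegaR M a) := by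
    unfold Sig
    fun_prop
  simp only [← Complex.ofReal_inv]
  exact (h.inv fun p hp => (Sig_pos_of_mem hM hp).ne').ofReal

lemma boxm_eq (haM : |a| ≤ M) {f : F3} (hf : ContDiffOn ℝ 2 f (OmegaR M a)) {p : ℝ × ℝ × ℝ}
    (hp : p ∈ OmegaR M a) :
    boxm M a m f p
      = (Complex.ofReal (Sig a p.2.1 p.2.2))⁻¹ * (radialOp M a m f p + angularOp a m f p) ∧
    barboxm M a m f p
      = (Complex.ofReal (Sig a p.2.1 p.2.2))⁻¹ *
          (Complex.ofReal (a ^ 2 * Real.cos p.2.2 ^ 2) * radialOp M a m f p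
            - Complex.ofReal (p.2.1 ^ 2) * angularOp a m f p)
        + (Complex.ofReal (Sig a p.2.1 p.2.2))⁻¹ * Complex.ofReal (Sig a p.2.1 p.2.2) *
            (2 * Complex.I * m * a) * dirDeriv (1, 0, 0) f p := by
  have hU := isOpen_OmegaR M a
  have hD : (Del M a p.2.1 : ℂ) ≠ 0 := Complex.ofReal_ne_zero.2 (Del_pos_of_mem haM hp).ne'
  have hs : Complex.sin p.2.2 ≠ 0 := by
    exact_mod_cast (sin_pos_of_mem hp).ne'
  have hT := dT_eq_dirDeriv (hf.differentiableAt_of_isOpen hU two_ne_zero hp)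
  have hTT : dT (dT f) p = dirDeriv (1, 0, 0) (dirDeriv (1, 0, 0) f) p := by
    have := partial_mul_partial hU dT_eq_dirDeriv (c := fun _ => 1) (by fun_prop) hf hp
    simpa [dT] using this
  have hdDel : Differentiable ℝ fun q : ℝ × ℝ × ℝ => Del M a q.2.1 := by
    unfold Del
    fun_prop
  have hdsin : Differentiable ℝ fun q : ℝ × ℝ × ℝ => Real.sin q.2.2 := by fun_prop
  have hRR := partial_mul_partial hU dR_eq_dirDeriv
    (c := fun q => Complex.ofReal (Del M a q.2.1))
    (Complex.ofRealCLM.differentiable.comp hdDel) hf hp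
  have hHH := partial_mul_partial hU dTh_eq_dirDeriv
    (c := fun q => Complex.ofReal (Real.sin q.2.2))
    (Complex.ofRealCLM.differentiable.comp hdsin) hf hp
  have hR : dR (fun q => Complex.ofReal (Del M a q.2.1)) p = 2 * p.2.1 - 2 * M := by
    have h : HasDerivAt (Del M a) (2 * p.2.1 - 2 * M) p.2.1 := by
      have := ((hasDerivAt_pow 2 p.2.1).sub ((hasDerivAt_id' p.2.1).const_mul (2 * M))).add_const
        (a ^ 2)
      exact this.congr_deriv (by norm_num)
    simpa using! h.ofReal_comp.deriv
  have hH : dTh (fun q => Complex.ofReal (Real.sin q.2.2)) p = Real.cos p.2.2 :=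
    (Real.hasDerivAt_sin p.2.2).ofReal_comp.deriv
  have hDel : (Del M a p.2.1 : ℂ) = (p.2.1 : ℂ) ^ 2 - 2 * M * p.2.1 + (a : ℂ) ^ 2 := by
    simp [Del]
  unfold boxm barboxm
  rw [hT, hTT, hRR, hHH, hR, hH]
  constructor
  · congr 1
    simp [radialOp, angularOp, secondOrderOp, radialCoeff, angularCoeff]
    field_simp
    ring
  · rw [mul_assoc _ (Complex.ofReal (Sig a p.2.1 p.2.2)), mul_assoc _ (_ * _), ← mul_add]
    congr 1
    simp [radialOp, angularOp, secondOrderOp, radialCoeff, angularCoeff, Sig]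
    field_simp
    linear_combination (-2 * Complex.I * m * a ^ 3 * Complex.cos p.2.2 ^ 2 *
      Complex.sin p.2.2 ^ 2 * dirDeriv (1, 0, 0) f p) * hDel

lemma dirDeriv_radialCoeff {v : ℝ × ℝ × ℝ} (hv : v.2.1 = 0) (i : Fin 5) (p : ℝ × ℝ × ℝ) :
    dirDeriv v (radialCoeff M a m i) p = 0 :=
  dirDeriv_eq_zero_of_invariant (fun p s => by simp [radialCoeff, hv]) p

lemma dirDeriv_angularCoeff {v : ℝ × ℝ × ℝ} (hv : v.2.2 = 0) (i : Fin 5) (p : ℝ × ℝ × ℝ) :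
    dirDeriv v (angularCoeff a m i) p = 0 :=
  dirDeriv_eq_zero_of_invariant (fun p s => by simp [angularCoeff, hv]) p

lemma contDiffOn_radialOp (haM : |a| ≤ M) {n : WithTop ℕ∞} {f : F3}
    (hf : ContDiffOn ℝ (n + 2) f (OmegaR M a)) :
    ContDiffOn ℝ n (radialOp M a m f) (OmegaR M a) :=
  ContDiffOn.secondOrderOp (isOpen_OmegaR M a) (fun i => contDiffOn_radialCoeff haM i) hf

lemma contDiffOn_angularOp {n : WithTop ℕ∞} {f : F3} (hf : ContDiffOn ℝ (n + 2) f (OmegaR M a)) :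
    ContDiffOn ℝ n (angularOp a m f) (OmegaR M a) :=
  ContDiffOn.secondOrderOp (isOpen_OmegaR M a) (fun i => contDiffOn_angularCoeff i) hf

end Kerr

/-- `□ₘ` and `□̄ₘ` commute on `C⁴` functions on `Ω_r`. -/
theorem boxm_barboxm_comm (M a : ℝ) (m : ℤ) (hM : 0 < M) (ha : 0 ≤ a) (haM : a ≤ M)
    (u : F3) (hu : ContDiffOn ℝ 4 u (OmegaR M a)) :
    ∀ p ∈ OmegaR M a,
      boxm M a m (barboxm M a m u) p = barboxm M a m (boxm M a m u) p := by
  intro p hp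
  have haM' : |a| ≤ M := by rwa [abs_of_nonneg ha]
  have hU := isOpen_OmegaR M a
  have hu2 : ContDiffOn ℝ 2 u (OmegaR M a) := hu.of_le (by norm_num)
  have hu3 : ContDiffOn ℝ 3 u (OmegaR M a) := hu.of_le (by norm_num)
  have hu4 : ContDiffOn ℝ (2 + 2) u (OmegaR M a) := by convert hu; norm_num
  have hSne {q : ℝ × ℝ × ℝ} (hq : q ∈ OmegaR M a) : (Sig a q.2.1 q.2.2 : ℂ) ≠ 0 :=
    Complex.ofReal_ne_zero.2 (Sig_pos_of_mem hM hq).ne'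
  let t : ℝ × ℝ × ℝ := (1, 0, 0)
  let x : F3 := fun q => Complex.ofReal (a ^ 2 * Real.cos q.2.2 ^ 2)
  let y : F3 := fun q => Complex.ofReal (q.2.1 ^ 2)
  let S : F3 := fun q => (Complex.ofReal (Sig a q.2.1 q.2.2))⁻¹
  let A : F3 := radialOp M a m u
  let B : F3 := angularOp a m u
  let F : F3 := fun q => S q * (A q + B q)
  let G : F3 := fun q => S q * (x q * A q + (-1) * (y q * B q))
  let c : ℂ := 2 * Complex.I * m * a
  have hS : ContDiffOn ℝ 2 S (OmegaR M a) := contDiffOn_inv_Sig hM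
  have hx : ContDiffOn ℝ 2 x (OmegaR M a) := by
    refine ContDiffOn.ofReal (ContDiff.contDiffOn ?_)
    fun_prop
  have hy : ContDiffOn ℝ 2 y (OmegaR M a) := by
    refine ContDiffOn.ofReal (ContDiff.contDiffOn ?_)
    fun_prop
  have hA : ContDiffOn ℝ 2 A (OmegaR M a) := contDiffOn_radialOp haM' hu4
  have hB : ContDiffOn ℝ 2 B (OmegaR M a) := contDiffOn_angularOp hu4
  have hF : ContDiffOn ℝ 2 F (OmegaR M a) := hS.mul (hA.add hB)
  have hG : ContDiffOn ℝ 2 G (OmegaR M a) :=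
    hS.mul ((hx.mul hA).add (contDiffOn_const.mul (hy.mul hB)))
  have hut : ContDiffOn ℝ 2 (dirDeriv t u) (OmegaR M a) := hu3.dirDeriv hU (by norm_num) t
  have hcut : ContDiffOn ℝ 2 (fun q => c * dirDeriv t u q) (OmegaR M a) :=
    contDiffOn_const.mul hut
  have hbox : Set.EqOn (boxm M a m u) F (OmegaR M a) := fun q hq => (boxm_eq haM' hu2 hq).1
  have hbar : Set.EqOn (barboxm M a m u) (fun q => G q + c * dirDeriv t u q) (OmegaR M a) := by
    intro q hq
    rw [(boxm_eq haM' hu2 hq).2, inv_mul_cancel₀ (hSne hq)]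
    simp only [G, S, x, y, A, B, c, t]
    ring
  have hxy {q : ℝ × ℝ × ℝ} (hq : q ∈ OmegaR M a) : S q * (x q + y q) = 1 := by
    rw [← inv_mul_cancel₀ (hSne hq)]
    simp only [S, x, y, Sig]
    push_cast
    ring
  have key := separated_comm hU (t := t) (v := (0, 1, 0)) (w := (0, 0, 1)) (x := x) (y := y)
    (fun i => contDiffOn_radialCoeff haM' i) (fun i => contDiffOn_angularCoeff i)
    (fun i q _ => dirDeriv_radialCoeff (m := m) rfl i q)
    (fun i q _ => dirDeriv_radialCoeff rfl i q)
    (fun i q _ => dirDeriv_angularCoeff (m := m) rfl i q)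
    (fun i q _ => dirDeriv_angularCoeff rfl i q) hu hx hy
    (fun q _ => dirDeriv_eq_zero_of_invariant (fun p s => by simp [x, t]) q)
    (fun q _ => dirDeriv_eq_zero_of_invariant (fun p s => by simp [x]) q)
    (fun q _ => dirDeriv_eq_zero_of_invariant (fun p s => by simp [y, t]) q)
    (fun q _ => dirDeriv_eq_zero_of_invariant (fun p s => by simp [y]) q) hF hG
    (fun q hq => by
      change A q = y q * (S q * (A q + B q)) + S q * (x q * A q + (-1) * (y q * B q))
      linear_combination (-A q) * hxy hq)
    (fun q hq => by
      change B q = x q * (S q * (A q + B q)) + (-1) * (S q * (x q * A q + (-1) * (y q * B q)))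
      linear_combination (-B q) * hxy hq) hp
  change x p * radialOp M a m F p - y p * angularOp a m F p
    = radialOp M a m G p + angularOp a m G p at key
  have hc (v : ℝ × ℝ × ℝ) : ∀ q ∈ OmegaR M a, dirDeriv v (fun _ => c) q = 0 := fun q _ =>
    dirDeriv_eq_zero_of_invariant (fun _ _ => rfl) q
  have hAK : radialOp M a m (barboxm M a m u) p
      = radialOp M a m G p + c * radialOp M a m (dirDeriv t u) p := by
    unfold radialOp
    rw [secondOrderOp_congr hU hbar hp, secondOrderOp_add hU hG hcut hp,
      secondOrderOp_mul hU contDiffOn_const hut (hc _) (hc _) hp]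
  have hBK : angularOp a m (barboxm M a m u) p
      = angularOp a m G p + c * angularOp a m (dirDeriv t u) p := by
    unfold angularOp
    rw [secondOrderOp_congr hU hbar hp, secondOrderOp_add hU hG hcut hp,
      secondOrderOp_mul hU contDiffOn_const hut (hc _) (hc _) hp]
  have hAF : radialOp M a m (boxm M a m u) p = radialOp M a m F p :=
    secondOrderOp_congr hU hbox hp
  have hBF : angularOp a m (boxm M a m u) p = angularOp a m F p :=
    secondOrderOp_congr hU hbox hp
  have hTF : dirDeriv t (boxm M a m u) p
      = S p * (radialOp M a m (dirDeriv t u) p + angularOp a m (dirDeriv t u) p) := by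
    have hA1 := hA.differentiableAt_of_isOpen hU two_ne_zero hp
    have hB1 := hB.differentiableAt_of_isOpen hU two_ne_zero hp
    rw [dirDeriv_congr hU hbox t hp,
      dirDeriv_mul_of_eq_zero (hS.differentiableAt_of_isOpen hU two_ne_zero hp)
        (hA1.fun_add hB1) (dirDeriv_eq_zero_of_invariant (fun p s => by simp [S, t]) p),
      dirDeriv_add hA1 hB1]
    congr 2
    · exact dirDeriv_secondOrderOp hU (fun i => contDiffOn_radialCoeff haM' i)
        (fun i q _ => dirDeriv_radialCoeff rfl i q) hu3 hp
    · exact dirDeriv_secondOrderOp hU (fun i => contDiffOn_angularCoeff i)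
        (fun i q _ => dirDeriv_angularCoeff rfl i q) hu3 hp
  rw [(boxm_eq haM' ((hG.add hcut).congr hbar) hp).1, (boxm_eq haM' (hF.congr hbox) hp).2,
    hAK, hBK, hAF, hBF, hTF, inv_mul_cancel₀ (hSne hp)]
  linear_combination (-S p) * key
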